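/- Let n ≥ 3, let p be a real number with p ≥ (n+2)/(n−2), and let R > 0. Then there is no pair of functions u, v, each twice continuously differentiable on a neighborhood of the closed ball B̄_R ⊂ ℝ^n, such that −Δu = v^p − u^p and −Δv = u^p in B_R, u > 0 and v > 0 in B_R, and u = v = 0 on ∂B_R. -/

import Mathlib

noncomputable section
open Set Metric
open scoped BigOperators

/-- The Laplace operator on `ℝ^n`, as the sum of second partial derivatives. -/
def lap {n : ℕ} (u : EuclideanSpace ℝ (Fin n) → ℝ) (x : EuclideanSpace ℝ (Fin n)) : ℝ :=
  ∑ i, fderiv ℝ (fun y => fderiv ℝ u y (EuclideanSpace.single i 1)) x (EuclideanSpace.single i 1)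

open MeasureTheory Filter Topology

/-- The divergence of the vector field with components `V i`. -/
def divergence {n : ℕ} (V : Fin n → EuclideanSpace ℝ (Fin n) → ℝ)
    (x : EuclideanSpace ℝ (Fin n)) : ℝ :=
  ∑ i, fderiv ℝ (V i) x (EuclideanSpace.single i 1)

theorem ContDiff.integral_fderiv_apply_eq_zero {n : ℕ} {f : EuclideanSpace ℝ (Fin n) → ℝ}
    (hf : ContDiff ℝ 1 f) (hc : HasCompactSupport f) (e : EuclideanSpace ℝ (Fin n)) :
    ∫ x, fderiv ℝ f x e = 0 := by
  have h := integral_mul_fderiv_eq_neg_fderiv_mul_of_integrable (μ := volume)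
    (f := fun _ : EuclideanSpace ℝ (Fin n) => (1 : ℝ)) (g := f) (v := e)
    (by simp)
    (by
      simp only [one_mul]
      exact ((hf.continuous_fderiv one_ne_zero).clm_apply
        continuous_const).integrable_of_hasCompactSupport (hc.fderiv_apply ℝ e))
    (by simpa using hf.continuous.integrable_of_hasCompactSupport hc)
    (fun x _ => differentiableAt_const _)
    (fun x _ => hf.differentiable one_ne_zero x)
  simpa using h

theorem contDiff_mul_of_eq_zero_off_ball {n : ℕ} {R : ℝ} {U : Set (EuclideanSpace ℝ (Fin n))}
    {η f : EuclideanSpace ℝ (Fin n) → ℝ} (hU : IsOpen U) (hRU : closedBall 0 R ⊆ U)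
    (hη : ContDiff ℝ 1 η) (h0 : ∀ x ∉ ball 0 R, η x = 0) (hf : ContDiffOn ℝ 1 f U) :
    ContDiff ℝ 1 (fun x => η x * f x) := by
  rw [contDiff_iff_contDiffAt]
  intro x
  by_cases hx : x ∈ closedBall 0 R
  · exact hη.contDiffAt.mul (hf.contDiffAt (hU.mem_nhds (hRU hx)))
  · refine (contDiffAt_const (c := (0 : ℝ))).congr_of_eventuallyEq ?_
    filter_upwards [isClosed_closedBall.isOpen_compl.mem_nhds hx] with y hy
    simp [h0 y (fun h => hy (ball_subset_closedBall h))]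

theorem continuousOn_divergence {n : ℕ} {U : Set (EuclideanSpace ℝ (Fin n))}
    {V : Fin n → EuclideanSpace ℝ (Fin n) → ℝ} (hU : IsOpen U)
    (hV : ∀ i, ContDiffOn ℝ 1 (V i) U) : ContinuousOn (divergence V) U :=
  continuousOn_finsetSum _ fun i _ =>
    ((hV i).continuousOn_fderiv_of_isOpen hU le_rfl).clm_apply continuousOn_const

theorem setIntegral_cutoff_mul_divergence_nonneg {n : ℕ} {R : ℝ}
    {U : Set (EuclideanSpace ℝ (Fin n))} {η : EuclideanSpace ℝ (Fin n) → ℝ}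
    {V : Fin n → EuclideanSpace ℝ (Fin n) → ℝ} (hU : IsOpen U) (hRU : closedBall 0 R ⊆ U)
    (hη : ContDiff ℝ 1 η) (h0 : ∀ x ∉ ball 0 R, η x = 0) (hV : ∀ i, ContDiffOn ℝ 1 (V i) U)
    (hflux : ∀ x ∈ ball 0 R, ∑ i, V i x * fderiv ℝ η x (EuclideanSpace.single i 1) ≤ 0) :
    0 ≤ ∫ x in ball 0 R, η x * divergence V x := by
  have hsm i := contDiff_mul_of_eq_zero_off_ball hU hRU hη h0 (hV i)
  have hz i : ∀ x ∉ closedBall (0 : EuclideanSpace ℝ (Fin n)) R, η x * V i x = 0 := fun x hx => by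
    simp [h0 x (fun h => hx (ball_subset_closedBall h))]
  have hcs i : HasCompactSupport (fun x => η x * V i x) :=
    HasCompactSupport.intro (isCompact_closedBall 0 R) (hz i)
  have hfd_int i : Integrable (fun x => fderiv ℝ (fun x => η x * V i x) x
      (EuclideanSpace.single i 1)) :=
    (((hsm i).continuous_fderiv one_ne_zero).clm_apply
      continuous_const).integrable_of_hasCompactSupport ((hcs i).fderiv_apply ℝ _)
  have hsum : ∫ x, divergence (fun i x => η x * V i x) x = 0 := by
    simp only [divergence]
    rw [integral_finsetSum _ fun i _ => hfd_int i]
    exact Finset.sum_eq_zero fun i _ => (hsm i).integral_fderiv_apply_eq_zero (hcs i) _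
  have hball : ∫ x in closedBall 0 R, divergence (fun i x => η x * V i x) x = 0 := by
    rw [← hsum]
    refine setIntegral_eq_integral_of_forall_compl_eq_zero fun x hx => ?_
    refine Finset.sum_eq_zero fun i _ => ?_
    have : (fun x => η x * V i x) =ᶠ[𝓝 x] fun _ => 0 := by
      filter_upwards [isClosed_closedBall.isOpen_compl.mem_nhds hx] with y hy using hz i y hy
    simp [this.fderiv_eq]
  have hball : ∫ x in ball 0 R, divergence (fun i x => η x * V i x) x = 0 := by
    rcases eq_or_ne n 0 with rfl | hn
    · simp [divergence]
    · have : Nonempty (Fin n) := ⟨⟨0, Nat.pos_of_ne_zero hn⟩⟩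
      rw [← hball]
      exact setIntegral_congr_set
        (ae_eq_set.2 ⟨by rw [sdiff_eq_empty.2 ball_subset_closedBall, measure_empty],
          by rw [closedBall_sdiff_ball]; exact Measure.addHaar_sphere _ _ _⟩)
  rw [← hball]
  refine setIntegral_mono_on ?_ ?_ measurableSet_ball fun x hx => ?_
  · exact (integrable_finsetSum _ fun i _ => hfd_int i).integrableOn
  · exact ((hη.continuous.continuousOn.mul
      ((continuousOn_divergence hU hV).mono hRU)).integrableOn_compact
      (isCompact_closedBall 0 R)).mono_set ball_subset_closedBall
  · have hd i : DifferentiableAt ℝ (V i) x :=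
      ((hV i).contDiffAt (hU.mem_nhds (hRU (ball_subset_closedBall hx)))).differentiableAt
        one_ne_zero
    have hη' := (hη.differentiable one_ne_zero) x
    have : divergence (fun i x => η x * V i x) x = η x * divergence V x
        + ∑ i, V i x * fderiv ℝ η x (EuclideanSpace.single i 1) := by
      simp only [divergence, Finset.mul_sum, ← Finset.sum_add_distrib]
      refine Finset.sum_congr rfl fun i _ => ?_
      rw [fderiv_fun_mul hη' (hd i)]
      simp
    linarith [hflux x hx]

/-- The radial cutoff equal to `1` where `1 ≤ k * (R ^ 2 - ‖x‖ ^ 2)` and to `0` off `ball 0 R`. -/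
def radialCutoff (n : ℕ) (R k : ℝ) (x : EuclideanSpace ℝ (Fin n)) : ℝ :=
  Real.smoothTransition (k * (R ^ 2 - ‖x‖ ^ 2))

theorem contDiff_radialCutoff (n : ℕ) (R k : ℝ) : ContDiff ℝ 1 (radialCutoff n R k) :=
  Real.smoothTransition.contDiff.comp
    (contDiff_const.mul (contDiff_const.sub (contDiff_norm_sq ℝ)))

theorem fderiv_radialCutoff_single {n : ℕ} (R k : ℝ) (x : EuclideanSpace ℝ (Fin n)) (i : Fin n) :
    fderiv ℝ (radialCutoff n R k) x (EuclideanSpace.single i 1) =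
      -(2 * k * deriv Real.smoothTransition (k * (R ^ 2 - ‖x‖ ^ 2))) * x i := by
  have h1 : HasDerivAt Real.smoothTransition
      (deriv Real.smoothTransition (k * (R ^ 2 - ‖x‖ ^ 2))) (k * (R ^ 2 - ‖x‖ ^ 2)) :=
    ((Real.smoothTransition.contDiff (n := 1)).differentiable one_ne_zero _).hasDerivAt
  have h2 : HasFDerivAt (fun y : EuclideanSpace ℝ (Fin n) => k * (R ^ 2 - ‖y‖ ^ 2)) _ x :=
    (((hasStrictFDerivAt_norm_sq x).hasFDerivAt).const_sub (R ^ 2)).const_mul k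
  have h3 : HasFDerivAt (radialCutoff n R k) _ x := h1.comp_hasFDerivAt x h2
  rw [h3.fderiv]
  simp [EuclideanSpace.inner_single_right]
  ring

theorem radialCutoff_of_notMem_ball {n : ℕ} {R k : ℝ} (hR : 0 ≤ R) (hk : 0 ≤ k)
    {x : EuclideanSpace ℝ (Fin n)} (hx : x ∉ ball 0 R) : radialCutoff n R k x = 0 := by
  rw [mem_ball_zero_iff, not_lt] at hx
  apply Real.smoothTransition.zero_of_nonpos
  have : R ^ 2 ≤ ‖x‖ ^ 2 := by gcongr
  nlinarith

theorem setIntegral_divergence_nonneg_of_flux_pos {n : ℕ} {R : ℝ} (hR : 0 ≤ R)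
    {U : Set (EuclideanSpace ℝ (Fin n))} {V : Fin n → EuclideanSpace ℝ (Fin n) → ℝ}
    (hU : IsOpen U) (hRU : closedBall 0 R ⊆ U) (hV : ∀ i, ContDiffOn ℝ 1 (V i) U)
    (hflux : ∀ x ∈ sphere 0 R, 0 < ∑ i, x i * V i x) :
    0 ≤ ∫ x in ball 0 R, divergence V x := by
  obtain ⟨r, hr, hrV⟩ : ∃ r < R ^ 2, ∀ x ∈ closedBall (0 : EuclideanSpace ℝ (Fin n)) R,
      r < ‖x‖ ^ 2 → 0 ≤ ∑ i, x i * V i x := by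
    have hcont : ContinuousOn (fun x => ∑ i, x i * V i x) (closedBall 0 R) :=
      continuousOn_finsetSum _ fun i _ =>
        (by fun_prop : Continuous fun x : EuclideanSpace ℝ (Fin n) => x i).continuousOn.mul
          ((hV i).continuousOn.mono hRU)
    have hK : IsCompact (closedBall (0 : EuclideanSpace ℝ (Fin n)) R ∩
        (fun x => ∑ i, x i * V i x) ⁻¹' Iic 0) :=
      (isCompact_closedBall 0 R).of_isClosed_subset
        (hcont.preimage_isClosed_of_isClosed isClosed_closedBall isClosed_Iic) inter_subset_left
    rcases eq_empty_or_nonempty (closedBall (0 : EuclideanSpace ℝ (Fin n)) R ∩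
        (fun x => ∑ i, x i * V i x) ⁻¹' Iic 0) with hE | hE
    · refine ⟨R ^ 2 - 1, by linarith, fun x hx _ => ?_⟩
      by_contra! hneg
      exact hE.subset ⟨hx, hneg.le⟩
    · obtain ⟨y, hy, hmax⟩ := hK.exists_isMaxOn hE
        (f := fun x => ‖x‖ ^ 2) (by fun_prop)
      refine ⟨‖y‖ ^ 2, ?_, fun x hx hlt => ?_⟩
      · have hyR : ‖y‖ ≤ R := by simpa using hy.1
        have : ‖y‖ < R := by
          refine lt_of_le_of_ne hyR fun h => ?_
          exact absurd (hflux y (by simpa using h)) (not_lt.2 hy.2)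
        gcongr
      · by_contra! hneg
        exact absurd (hmax ⟨hx, hneg.le⟩) (not_le.2 hlt)
  have hlim : Tendsto (fun k : ℕ => ∫ x in ball 0 R, radialCutoff n R k x * divergence V x) atTop
      (𝓝 (∫ x in ball 0 R, divergence V x)) := by
    have hdc : ContinuousOn (divergence V) (closedBall 0 R) :=
      (continuousOn_divergence hU hV).mono hRU
    have hdi : IntegrableOn (divergence V) (ball 0 R) :=
      (hdc.integrableOn_compact (isCompact_closedBall 0 R)).mono_set ball_subset_closedBall
    refine tendsto_integral_of_dominated_convergence (fun x => ‖divergence V x‖) (fun k => ?_)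
      hdi.norm (fun k => ?_) ?_
    · exact (contDiff_radialCutoff n R k).continuous.aestronglyMeasurable.mul
        hdi.aestronglyMeasurable
    · refine Eventually.of_forall fun x => ?_
      rw [norm_mul, radialCutoff, Real.norm_of_nonneg (Real.smoothTransition.nonneg _)]
      exact mul_le_of_le_one_left (norm_nonneg _) (Real.smoothTransition.le_one _)
    · refine (ae_restrict_iff' measurableSet_ball).2 (Eventually.of_forall fun x hx => ?_)
      rw [mem_ball_zero_iff] at hx
      have hpos : 0 < R ^ 2 - ‖x‖ ^ 2 := by
        have : ‖x‖ ^ 2 < R ^ 2 := by gcongr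
        linarith
      refine tendsto_const_nhds.congr' ?_
      filter_upwards [(tendsto_natCast_atTop_atTop (R := ℝ)).eventually_ge_atTop
        (1 / (R ^ 2 - ‖x‖ ^ 2))] with k hk
      rw [div_le_iff₀ hpos] at hk
      rw [radialCutoff, Real.smoothTransition.one_of_one_le hk, one_mul]
  refine ge_of_tendsto hlim ?_
  filter_upwards [(tendsto_natCast_atTop_atTop (R := ℝ)).eventually_gt_atTop
    (1 / (R ^ 2 - r))] with k hk
  rw [div_lt_iff₀ (by linarith)] at hk
  refine setIntegral_cutoff_mul_divergence_nonneg hU hRU (contDiff_radialCutoff n R k)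
    (fun x hx => radialCutoff_of_notMem_ball hR k.cast_nonneg hx) hV fun x hx => ?_
  have heq : ∑ i, V i x * fderiv ℝ (radialCutoff n R k) x (EuclideanSpace.single i 1) =
      -(2 * k * deriv Real.smoothTransition (k * (R ^ 2 - ‖x‖ ^ 2))) * ∑ i, x i * V i x := by
    simp only [fderiv_radialCutoff_single, Finset.mul_sum]
    exact Finset.sum_congr rfl fun i _ => by ring
  rw [heq]
  rcases le_or_gt (‖x‖ ^ 2) r with hxr | hxr
  · have h1 : 1 < k * (R ^ 2 - ‖x‖ ^ 2) :=
      hk.trans_le (mul_le_mul_of_nonneg_left (by linarith) k.cast_nonneg)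
    have : Real.smoothTransition =ᶠ[𝓝 (k * (R ^ 2 - ‖x‖ ^ 2))] fun _ => 1 := by
      filter_upwards [Ioi_mem_nhds h1] with t ht
      exact Real.smoothTransition.one_of_one_le (le_of_lt ht)
    simp [this.deriv_eq]
  · have h1 := hrV x (ball_subset_closedBall hx) hxr
    have h2 : 0 ≤ deriv Real.smoothTransition (k * (R ^ 2 - ‖x‖ ^ 2)) :=
      Real.smoothTransition.monotone.deriv_nonneg
    have : 0 ≤ 2 * (k : ℝ) * deriv Real.smoothTransition (k * (R ^ 2 - ‖x‖ ^ 2)) *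
      ∑ i, x i * V i x := by positivity
    linarith

/-- A vector field that points outwards along the boundary of a ball has nonnegative total
divergence. -/
theorem setIntegral_divergence_nonneg {n : ℕ} {R : ℝ} (hR : 0 < R)
    {U : Set (EuclideanSpace ℝ (Fin n))} {V : Fin n → EuclideanSpace ℝ (Fin n) → ℝ}
    (hU : IsOpen U) (hRU : closedBall 0 R ⊆ U) (hV : ∀ i, ContDiffOn ℝ 1 (V i) U)
    (hflux : ∀ x ∈ sphere 0 R, 0 ≤ ∑ i, x i * V i x) :
    0 ≤ ∫ x in ball 0 R, divergence V x := by
  have hdi : IntegrableOn (divergence V) (ball 0 R) :=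
    (((continuousOn_divergence hU hV).mono hRU).integrableOn_compact
      (isCompact_closedBall 0 R)).mono_set ball_subset_closedBall
  have hcoord i : ContDiff ℝ 1 fun x : EuclideanSpace ℝ (Fin n) => x i := by fun_prop
  have key : ∀ δ : ℝ, 0 < δ → 0 ≤ (∫ x in ball 0 R, divergence V x) +
      δ * (n * volume.real (ball (0 : EuclideanSpace ℝ (Fin n)) R)) := by
    intro δ hδ
    have h := setIntegral_divergence_nonneg_of_flux_pos hR.le hU hRU
      (V := fun i x => V i x + δ * x i)
      (fun i => (hV i).add (contDiff_const.mul (hcoord i)).contDiffOn) fun x hx => ?_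
    · have hdiv : ∀ x ∈ ball (0 : EuclideanSpace ℝ (Fin n)) R,
          divergence (fun i x => V i x + δ * x i) x = divergence V x + δ * n := by
        intro x hx
        have hsum : δ * (n : ℝ) = ∑ _i : Fin n, δ := by simp [mul_comm]
        simp only [divergence, hsum, ← Finset.sum_add_distrib]
        refine Finset.sum_congr rfl fun i _ => ?_
        have h1 : DifferentiableAt ℝ (V i) x :=
          ((hV i).contDiffAt (hU.mem_nhds (hRU (ball_subset_closedBall hx)))).differentiableAt
            one_ne_zero
        have h2 : HasFDerivAt (fun y : EuclideanSpace ℝ (Fin n) => y i)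
          (EuclideanSpace.proj i : EuclideanSpace ℝ (Fin n) →L[ℝ] ℝ) x :=
          (EuclideanSpace.proj i : EuclideanSpace ℝ (Fin n) →L[ℝ] ℝ).hasFDerivAt
        rw [(h1.hasFDerivAt.fun_add (h2.const_mul δ)).fderiv]
        simp
      rw [setIntegral_congr_fun measurableSet_ball hdiv, integral_add hdi
        (integrableOn_const measure_ball_lt_top.ne), setIntegral_const, smul_eq_mul] at h
      linarith
    · have hx' : ∑ i, x i * x i = R ^ 2 := by
        rw [mem_sphere_zero_iff_norm] at hx
        rw [← hx, EuclideanSpace.real_norm_sq_eq]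
        simp [sq]
      have : ∑ i, x i * (V i x + δ * x i) = (∑ i, x i * V i x) + δ * R ^ 2 := by
        rw [← hx', Finset.mul_sum, ← Finset.sum_add_distrib]
        exact Finset.sum_congr rfl fun i _ => by ring
      rw [this]
      have := hflux x hx
      positivity
  have hlim : Tendsto (fun δ : ℝ => (∫ x in ball 0 R, divergence V x) +
      δ * (n * volume.real (ball (0 : EuclideanSpace ℝ (Fin n)) R))) (𝓝[>] 0)
      (𝓝 ((∫ x in ball 0 R, divergence V x) +
      0 * (n * volume.real (ball (0 : EuclideanSpace ℝ (Fin n)) R)))) :=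
    (Continuous.tendsto (by fun_prop) 0).mono_left nhdsWithin_le_nhds
  rw [zero_mul, add_zero] at hlim
  exact ge_of_tendsto hlim (by filter_upwards [self_mem_nhdsWithin] with δ hδ using key δ hδ)

/-- On a sphere where `u` attains the value zero, with `u` nonnegative inside, the gradient of `u`
is a nonpositive multiple of the position vector. -/
theorem exists_nonpos_fderiv_eq_mul_inner {n : ℕ} {R : ℝ} (hR : 0 < R)
    {u : EuclideanSpace ℝ (Fin n) → ℝ} {x : EuclideanSpace ℝ (Fin n)} (hx : x ∈ sphere 0 R)
    (hu : ContDiffAt ℝ 1 u x) (hpos : ∀ y ∈ ball 0 R, 0 ≤ u y) (hzero : ∀ y ∈ sphere 0 R, u y = 0) :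
    ∃ c ≤ 0, ∀ y, fderiv ℝ u x y = c * inner ℝ x y := by
  rw [mem_sphere_zero_iff_norm] at hx
  have hux : u x = 0 := hzero x (by simpa using hx)
  have hext : IsLocalExtrOn u {y | ‖y‖ ^ 2 = ‖x‖ ^ 2} x := by
    refine Or.inl ?_
    filter_upwards [self_mem_nhdsWithin] with y hy
    have : ‖y‖ = ‖x‖ := (sq_eq_sq₀ (norm_nonneg _) (norm_nonneg _)).1 hy
    rw [hux, hzero y (by simpa using this.trans hx)]
  obtain ⟨a, b, hab, h⟩ := hext.exists_multipliers_of_hasStrictFDerivAt_1d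
    (hasStrictFDerivAt_norm_sq x) (hu.hasStrictFDerivAt one_ne_zero)
  have h' : ∀ y, a * (2 * inner ℝ x y) + b * fderiv ℝ u x y = 0 := fun y => by
    simpa using congrArg (fun f => f y) h
  have hxx : inner ℝ x x = R ^ 2 := by rw [real_inner_self_eq_norm_sq, hx]
  have hb : b ≠ 0 := by
    rintro rfl
    have h1 := h' x
    rw [hxx, zero_mul, add_zero] at h1
    have : a = 0 := by
      rcases mul_eq_zero.1 h1 with h | h
      · exact h
      · nlinarith [pow_pos hR 2]
    exact hab (by simp [this])
  have hc : ∀ y, fderiv ℝ u x y = (-(2 * a) / b) * inner ℝ x y := fun y => by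
    have := h' y
    field_simp
    linarith
  refine ⟨_, ?_, hc⟩
  have hline : HasDerivAt (fun t : ℝ => u (t • x)) (fderiv ℝ u x x) 1 := by
    have h1 : HasDerivAt (fun t : ℝ => t • x) ((1 : ℝ) • x) 1 := (hasDerivAt_id 1).smul_const x
    rw [one_smul] at h1
    have h2 : HasFDerivAt u (fderiv ℝ u x) ((1 : ℝ) • x) := by
      rw [one_smul]
      exact (hu.differentiableAt one_ne_zero).hasFDerivAt
    exact h2.comp_hasDerivAt 1 h1
  have hle : fderiv ℝ u x x ≤ 0 := by
    have hslope := (hasDerivWithinAt_iff_tendsto_slope' (by simp : (1 : ℝ) ∉ Iio 1)).1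
      hline.hasDerivWithinAt
    refine le_of_tendsto hslope ?_
    filter_upwards [Ioo_mem_nhdsLT (zero_lt_one (α := ℝ))] with t ht
    have h0 : 0 ≤ u (t • x) := hpos _ (by
      rw [mem_ball_zero_iff, norm_smul, Real.norm_of_nonneg ht.1.le, hx]
      nlinarith [ht.2])
    rw [slope_def_field, one_smul, hux]
    exact div_nonpos_of_nonneg_of_nonpos (by linarith) (by linarith [ht.2])
  rw [hc, hxx] at hle
  exact nonpos_of_mul_nonpos_left hle (pow_pos hR 2)

/-- The `i`-th partial derivative. -/
def pderiv {n : ℕ} (i : Fin n) (u : EuclideanSpace ℝ (Fin n) → ℝ)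
    (x : EuclideanSpace ℝ (Fin n)) : ℝ :=
  fderiv ℝ u x (EuclideanSpace.single i 1)

theorem ContDiffOn.pderiv {n : ℕ} {U : Set (EuclideanSpace ℝ (Fin n))} (hU : IsOpen U)
    {u : EuclideanSpace ℝ (Fin n) → ℝ} (hu : ContDiffOn ℝ 2 u U) (i : Fin n) :
    ContDiffOn ℝ 1 (pderiv i u) U :=
  (hu.fderiv_of_isOpen hU (by norm_num)).clm_apply contDiffOn_const

theorem pderiv_comm {n : ℕ} {u : EuclideanSpace ℝ (Fin n) → ℝ} {x : EuclideanSpace ℝ (Fin n)}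
    (hu : ContDiffAt ℝ 2 u x) (i j : Fin n) :
    pderiv i (pderiv j u) x = pderiv j (pderiv i u) x := by
  have hd : DifferentiableAt ℝ (fderiv ℝ u) x :=
    (hu.fderiv_right (m := 1) (by norm_num)).differentiableAt one_ne_zero
  have h (i j : Fin n) : pderiv i (pderiv j u) x =
      fderiv ℝ (fderiv ℝ u) x (EuclideanSpace.single i 1) (EuclideanSpace.single j 1) := by
    have := hd.hasFDerivAt.clm_apply (hasFDerivAt_const (EuclideanSpace.single j (1 : ℝ)) x)
    change fderiv ℝ (fun y => fderiv ℝ u y (EuclideanSpace.single j 1)) x _ = _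
    rw [this.fderiv]
    simp
  rw [h, h]
  exact hu.isSymmSndFDerivAt (by simp) _ _

/-- The vector field behind the Pohozaev identity of the system `-Δv = u ^ p`,
`-Δ(u + v) = v ^ p`: the dilation field, plus `(n - 2) / 2` times the energy field
`u ∇v + v ∇(u + v)`, plus `μ ∇v + c x`. -/
def pohozaevField {n : ℕ} (p μ c : ℝ) (u v : EuclideanSpace ℝ (Fin n) → ℝ) (i : Fin n)
    (x : EuclideanSpace ℝ (Fin n)) : ℝ :=
  (∑ j, x j * pderiv j u x) * pderiv i v x
    + (∑ j, x j * pderiv j v x) * (pderiv i u x + pderiv i v x)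
    - (∑ j, (pderiv j u x * pderiv j v x + 1 / 2 * (pderiv j v x * pderiv j v x))) * x i
    + 1 / (p + 1) * (u x ^ (p + 1) + v x ^ (p + 1)) * x i
    + ((n : ℝ) - 2) / 2 * (u x * pderiv i v x + v x * (pderiv i u x + pderiv i v x))
    + μ * pderiv i v x + c * x i

theorem contDiffOn_pohozaevField {n : ℕ} {p μ c : ℝ} (hp : 0 ≤ p)
    {U : Set (EuclideanSpace ℝ (Fin n))} (hU : IsOpen U)
    {u v : EuclideanSpace ℝ (Fin n) → ℝ} (hu : ContDiffOn ℝ 2 u U) (hv : ContDiffOn ℝ 2 v U)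
    (i : Fin n) : ContDiffOn ℝ 1 (pohozaevField p μ c u v i) U := by
  have hu1 := hu.of_le one_le_two
  have hv1 := hv.of_le one_le_two
  have hui := hu.pderiv hU
  have hvi := hv.pderiv hU
  have hx j : ContDiffOn ℝ 1 (fun x : EuclideanSpace ℝ (Fin n) => x j) U := by fun_prop
  have hpow : ContDiff ℝ 1 fun t : ℝ => t ^ (p + 1) := by
    exact_mod_cast Real.contDiff_rpow_const_of_le (n := 1) (by push_cast; linarith)
  have hup := hpow.comp_contDiffOn hu1
  have hvp := hpow.comp_contDiffOn hv1
  exact ((((((ContDiffOn.sum fun j _ => (hx j).mul (hui j)).mul (hvi i)).add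
    ((ContDiffOn.sum fun j _ => (hx j).mul (hvi j)).mul ((hui i).add (hvi i)))).sub
    ((ContDiffOn.sum fun j _ => ((hui j).mul (hvi j)).add
      (contDiffOn_const.mul ((hvi j).mul (hvi j)))).mul (hx i))).add
    ((contDiffOn_const.mul (hup.add hvp)).mul (hx i))).add
    (contDiffOn_const.mul ((hu1.mul (hvi i)).add (hv1.mul ((hui i).add (hvi i)))))).add
    (contDiffOn_const.mul (hvi i)) |>.add (contDiffOn_const.mul (hx i))

theorem pderiv_pohozaevField {n : ℕ} {p μ c : ℝ} (hp : 0 ≤ p)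
    {u v : EuclideanSpace ℝ (Fin n) → ℝ} {x : EuclideanSpace ℝ (Fin n)}
    (hu : DifferentiableAt ℝ u x) (hv : DifferentiableAt ℝ v x)
    (hui : ∀ j, DifferentiableAt ℝ (pderiv j u) x) (hvi : ∀ j, DifferentiableAt ℝ (pderiv j v) x)
    (i : Fin n) :
    pderiv i (pohozaevField p μ c u v i) x =
      (pderiv i u x + ∑ j, x j * pderiv i (pderiv j u) x) * pderiv i v x
      + (∑ j, x j * pderiv j u x) * pderiv i (pderiv i v) x
      + (pderiv i v x + ∑ j, x j * pderiv i (pderiv j v) x) * (pderiv i u x + pderiv i v x)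
      + (∑ j, x j * pderiv j v x) * (pderiv i (pderiv i u) x + pderiv i (pderiv i v) x)
      - (∑ j, (pderiv i (pderiv j u) x * pderiv j v x + pderiv j u x * pderiv i (pderiv j v) x
          + pderiv j v x * pderiv i (pderiv j v) x)) * x i
      - ∑ j, (pderiv j u x * pderiv j v x + 1 / 2 * (pderiv j v x * pderiv j v x))
      + (u x ^ p * pderiv i u x + v x ^ p * pderiv i v x) * x i
      + 1 / (p + 1) * (u x ^ (p + 1) + v x ^ (p + 1))
      + ((n : ℝ) - 2) / 2 * (pderiv i u x * pderiv i v x + u x * pderiv i (pderiv i v) x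
        + pderiv i v x * (pderiv i u x + pderiv i v x)
        + v x * (pderiv i (pderiv i u) x + pderiv i (pderiv i v) x))
      + μ * pderiv i (pderiv i v) x + c := by
  have hx j : HasFDerivAt (fun y : EuclideanSpace ℝ (Fin n) => y j)
      (EuclideanSpace.proj j : EuclideanSpace ℝ (Fin n) →L[ℝ] ℝ) x :=
    (EuclideanSpace.proj j : EuclideanSpace ℝ (Fin n) →L[ℝ] ℝ).hasFDerivAt
  have hup := hu.hasFDerivAt.rpow_const (p := p + 1) (Or.inr (by linarith))
  have hvp := hv.hasFDerivAt.rpow_const (p := p + 1) (Or.inr (by linarith))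
  have hu' := hu.hasFDerivAt
  have hv' := hv.hasFDerivAt
  have hui' j := (hui j).hasFDerivAt
  have hvi' j := (hvi j).hasFDerivAt
  have H : HasFDerivAt (pohozaevField p μ c u v i) _ x :=
    (((((((HasFDerivAt.fun_sum fun j _ => (hx j).fun_mul (hui' j)).fun_mul (hvi' i)).fun_add
    ((HasFDerivAt.fun_sum fun j _ => (hx j).fun_mul (hvi' j)).fun_mul
      ((hui' i).fun_add (hvi' i)))).fun_sub
    ((HasFDerivAt.fun_sum fun j _ => ((hui' j).fun_mul (hvi' j)).fun_add
      (((hvi' j).fun_mul (hvi' j)).const_mul (1 / 2))).fun_mul (hx i))).fun_add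
    (((hup.fun_add hvp).const_mul (1 / (p + 1))).fun_mul (hx i))).fun_add
    (((hu'.fun_mul (hvi' i)).fun_add
      (hv'.fun_mul ((hui' i).fun_add (hvi' i)))).const_mul (((n : ℝ) - 2) / 2))).fun_add
    ((hvi' i).const_mul μ)).fun_add ((hx i).const_mul c)
  have hproj j : (EuclideanSpace.proj j : EuclideanSpace ℝ (Fin n) →L[ℝ] ℝ)
      (EuclideanSpace.single i 1) = if j = i then 1 else 0 := by simp
  have hinv : 1 / (p + 1) * (p + 1) = 1 := one_div_mul_cancel (by positivity)
  have hcomm (f g : Fin n → ℝ) : ∑ j, f j * g j = ∑ j, g j * f j := by simp only [mul_comm]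
  rw [pderiv, H.fderiv]
  simp only [add_apply, sub_apply, smul_apply, sum_apply, smul_eq_mul, add_sub_cancel_right, hproj,
    mul_ite, mul_one, mul_zero, if_true, ← Finset.mul_sum, Finset.sum_add_distrib,
    Finset.sum_ite_eq', Finset.mem_univ, ← pderiv.eq_1]
  rw [hcomm fun j => pderiv i (pderiv j u) x]
  linear_combination x i * (u x ^ p * pderiv i u x + v x ^ p * pderiv i v x) * hinv
theorem divergence_pohozaevField {n : ℕ} {p μ c : ℝ} (hp : 0 ≤ p)
    {u v : EuclideanSpace ℝ (Fin n) → ℝ} {x : EuclideanSpace ℝ (Fin n)}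
    (hu : ContDiffAt ℝ 2 u x) (hv : ContDiffAt ℝ 2 v x) (hupos : 0 < u x) (hvpos : 0 < v x)
    (hequ : -lap u x = v x ^ p - u x ^ p) (heqv : -lap v x = u x ^ p) :
    divergence (pohozaevField p μ c u v) x =
      (n / (p + 1) - ((n : ℝ) - 2) / 2) * (u x ^ (p + 1) + v x ^ (p + 1)) - μ * u x ^ p + n * c := by
  have hd {f : EuclideanSpace ℝ (Fin n) → ℝ} (hf : ContDiffAt ℝ 2 f x) (j : Fin n) :
      DifferentiableAt ℝ (pderiv j f) x :=
    ((hf.fderiv_right (m := 1) (by norm_num)).differentiableAt one_ne_zero).clm_apply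
      (differentiableAt_const _)
  have hsym {f : EuclideanSpace ℝ (Fin n) → ℝ} (hf : ContDiffAt ℝ 2 f x) (g : Fin n → ℝ) :
      ∑ i, (∑ j, x j * pderiv i (pderiv j f) x) * g i =
        ∑ i, (∑ j, g j * pderiv i (pderiv j f) x) * x i := by
    simp only [Finset.sum_mul]
    rw [Finset.sum_comm]
    refine Finset.sum_congr rfl fun i _ => Finset.sum_congr rfl fun j _ => ?_
    rw [pderiv_comm hf]
    ring
  have hlap (f : EuclideanSpace ℝ (Fin n) → ℝ) : ∑ i, pderiv i (pderiv i f) x = lap f x := rfl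
  have hlv : lap v x = -u x ^ p := by linarith
  have hlu : lap u x = u x ^ p - v x ^ p := by linarith
  have h1 := hsym hu fun i => pderiv i v x
  have h2 := hsym hv fun i => pderiv i u x
  have h3 := hsym hv fun i => pderiv i v x
  have hpow {t : ℝ} (ht : 0 < t) : t ^ (p + 1) = t ^ p * t := Real.rpow_add_one ht.ne' p
  have hterm (i : Fin n) : fderiv ℝ (pohozaevField p μ c u v i) x (EuclideanSpace.single i 1) = _ :=
    pderiv_pohozaevField hp (hu.differentiableAt two_ne_zero) (hv.differentiableAt two_ne_zero)
      (hd hu) (hd hv) i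
  simp only [divergence, hterm]
  have hrad (a : ℝ) (f : EuclideanSpace ℝ (Fin n) → ℝ) :
      ∑ i, (a * pderiv i f x) * x i = a * ∑ i, x i * pderiv i f x := by
    rw [Finset.mul_sum]
    exact Finset.sum_congr rfl fun i _ => by ring
  have hmul (g h : Fin n → ℝ) : ∑ i, g i * h i = ∑ i, h i * g i := by simp only [mul_comm]
  have h4 := hmul (fun i => pderiv i v x) fun i => pderiv i u x
  have h5 (i : Fin n) := hmul (fun j => pderiv i (pderiv j u) x) fun j => pderiv j v x
  simp only [add_mul, mul_add, Finset.sum_add_distrib, Finset.sum_sub_distrib, ← Finset.mul_sum,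
    hrad, Finset.sum_const, Finset.card_univ, Fintype.card_fin, nsmul_eq_mul, hlap, h1, h2, h3, h4,
    h5, hlu, hlv, hpow hupos, hpow hvpos]
  ring

theorem sum_mul_pohozaevField_nonneg {n : ℕ} {p R lam : ℝ} (hp : 0 ≤ p) (hR : 0 < R)
    {u v : EuclideanSpace ℝ (Fin n) → ℝ} {x : EuclideanSpace ℝ (Fin n)} (hx : x ∈ sphere 0 R)
    (hu : ContDiffAt ℝ 1 u x) (hv : ContDiffAt ℝ 1 v x)
    (hupos : ∀ y ∈ ball 0 R, 0 ≤ u y) (hvpos : ∀ y ∈ ball 0 R, 0 ≤ v y)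
    (huzero : ∀ y ∈ sphere 0 R, u y = 0) (hvzero : ∀ y ∈ sphere 0 R, v y = 0) :
    0 ≤ ∑ i, x i * pohozaevField p (R * lam) (lam ^ 2 / 2) u v i x := by
  obtain ⟨a, ha, hua⟩ := exists_nonpos_fderiv_eq_mul_inner hR hx hu hupos huzero
  obtain ⟨b, hb, hvb⟩ := exists_nonpos_fderiv_eq_mul_inner hR hx hv hvpos hvzero
  have hui j : pderiv j u x = a * x j := by simp [pderiv, hua, EuclideanSpace.inner_single_right]
  have hvi j : pderiv j v x = b * x j := by simp [pderiv, hvb, EuclideanSpace.inner_single_right]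
  have hxx : ∑ i, x i * x i = R ^ 2 := by
    rw [mem_sphere_zero_iff_norm] at hx
    rw [← hx, EuclideanSpace.real_norm_sq_eq]
    simp [sq]
  have hxm (t : ℝ) : ∑ j, x j * (t * x j) = t * R ^ 2 := by
    rw [← hxx, Finset.mul_sum]
    exact Finset.sum_congr rfl fun j _ => by ring
  have hQ : ∑ j, (a * x j * (b * x j) + 1 / 2 * (b * x j * (b * x j))) =
      (a * b + b ^ 2 / 2) * R ^ 2 := by
    rw [← hxx, Finset.mul_sum]
    exact Finset.sum_congr rfl fun j _ => by ring
  have hterm i : x i * pohozaevField p (R * lam) (lam ^ 2 / 2) u v i x =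
      (R ^ 2 * (a * b) + (R * b + lam) ^ 2 / 2) * (x i * x i) := by
    simp only [pohozaevField, hui, hvi, hxm, hQ, huzero x hx, hvzero x hx,
      Real.zero_rpow (by positivity : p + 1 ≠ 0)]
    ring
  simp only [hterm, ← Finset.mul_sum, hxx]
  have := mul_nonneg_of_nonpos_of_nonpos ha hb
  positivity

/-- **Nonexistence for the Dirichlet problem** of the system `-Δu = v^p - u^p`, `-Δv = u^p`
on any ball of radius `R`, when `p ≥ (n+2)/(n-2)`. -/
theorem signChanging_Dirichlet_nonexistence (n : ℕ) (hn : 3 ≤ n) (p : ℝ)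
    (hp : ((n:ℝ) + 2) / ((n:ℝ) - 2) ≤ p) (R : ℝ) (hR : 0 < R) :
    ¬ ∃ (u v : EuclideanSpace ℝ (Fin n) → ℝ) (U : Set (EuclideanSpace ℝ (Fin n))),
      IsOpen U ∧ closedBall (0 : EuclideanSpace ℝ (Fin n)) R ⊆ U ∧
      ContDiffOn ℝ 2 u U ∧ ContDiffOn ℝ 2 v U ∧
      (∀ x ∈ ball (0 : EuclideanSpace ℝ (Fin n)) R, - lap u x = v x ^ p - u x ^ p) ∧
      (∀ x ∈ ball (0 : EuclideanSpace ℝ (Fin n)) R, - lap v x = u x ^ p) ∧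
      (∀ x ∈ ball (0 : EuclideanSpace ℝ (Fin n)) R, 0 < u x) ∧
      (∀ x ∈ ball (0 : EuclideanSpace ℝ (Fin n)) R, 0 < v x) ∧
      (∀ x ∈ sphere (0 : EuclideanSpace ℝ (Fin n)) R, u x = 0) ∧
      (∀ x ∈ sphere (0 : EuclideanSpace ℝ (Fin n)) R, v x = 0) := by
  rintro ⟨u, v, U, hU, hRU, hu, hv, hequ, heqv, hupos, hvpos, huzero, hvzero⟩
  have hn' : (3 : ℝ) ≤ n := by exact_mod_cast hn
  have hn2 : (0 : ℝ) < n - 2 := by linarith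
  have hp0 : 0 ≤ p := le_trans (by positivity) hp
  have hcrit : n / (p + 1) - ((n : ℝ) - 2) / 2 ≤ 0 := by
    rw [div_le_iff₀ hn2] at hp
    rw [sub_nonpos, div_le_div_iff₀ (by positivity) two_pos]
    linarith
  have hIntegrable {f : EuclideanSpace ℝ (Fin n) → ℝ} (hf : ContinuousOn f U) :
      IntegrableOn f (ball 0 R) :=
    ((hf.mono hRU).integrableOn_compact (isCompact_closedBall 0 R)).mono_set
      ball_subset_closedBall
  have hupi : IntegrableOn (fun x => u x ^ p) (ball 0 R) :=
    hIntegrable (hu.continuousOn.rpow_const fun _ _ => Or.inr hp0)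
  have hmass : 0 < ∫ x in ball 0 R, u x ^ p := by
    rw [setIntegral_pos_iff_support_of_nonneg_ae _ hupi]
    · refine (measure_ball_pos volume (0 : EuclideanSpace ℝ (Fin n)) hR).trans_le
        (measure_mono fun x hx => ⟨(Real.rpow_pos_of_pos (hupos x hx) p).ne', hx⟩)
    · exact (ae_restrict_iff' measurableSet_ball).2
        (Eventually.of_forall fun x hx => (Real.rpow_pos_of_pos (hupos x hx) p).le)
  have key : ∀ lam : ℝ, 0 < lam → R * ∫ x in ball 0 R, u x ^ p ≤
      lam * (n / 2 * volume.real (ball (0 : EuclideanSpace ℝ (Fin n)) R)) := by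
    intro lam hlam
    have hsm i := contDiffOn_pohozaevField (μ := R * lam) (c := lam ^ 2 / 2) hp0 hU hu hv i
    have hnonneg := setIntegral_divergence_nonneg hR hU hRU hsm fun x hx => by
      have hxU := hU.mem_nhds (hRU (sphere_subset_closedBall hx))
      exact sum_mul_pohozaevField_nonneg hp0 hR hx ((hu.contDiffAt hxU).of_le one_le_two)
        ((hv.contDiffAt hxU).of_le one_le_two) (fun y hy => (hupos y hy).le)
        (fun y hy => (hvpos y hy).le) huzero hvzero
    have hci : IntegrableOn (fun _ : EuclideanSpace ℝ (Fin n) => (n : ℝ) * (lam ^ 2 / 2))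
        (ball 0 R) := integrableOn_const measure_ball_lt_top.ne
    have hle : ∫ x in ball 0 R, divergence (pohozaevField p (R * lam) (lam ^ 2 / 2) u v) x ≤
        ∫ x in ball 0 R, (n * (lam ^ 2 / 2) - R * lam * u x ^ p) := by
      refine setIntegral_mono_on (hIntegrable (continuousOn_divergence hU hsm))
        (hci.sub (hupi.const_mul _))
        measurableSet_ball fun x hx => ?_
      have hxU := hU.mem_nhds (hRU (ball_subset_closedBall hx))
      have hux := hupos x hx
      have hvx := hvpos x hx
      rw [divergence_pohozaevField hp0 (hu.contDiffAt hxU) (hv.contDiffAt hxU) hux hvx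
        (hequ x hx) (heqv x hx)]
      have := mul_nonpos_of_nonpos_of_nonneg hcrit
        (by positivity : 0 ≤ u x ^ (p + 1) + v x ^ (p + 1))
      linarith
    rw [integral_sub hci (hupi.const_mul _),
      integral_const_mul (R * lam), setIntegral_const, smul_eq_mul] at hle
    refine le_of_mul_le_mul_left ?_ hlam
    linarith
  have hlim : Tendsto (fun lam : ℝ =>
      lam * (n / 2 * volume.real (ball (0 : EuclideanSpace ℝ (Fin n)) R))) (𝓝[>] 0)
      (𝓝 (0 * (n / 2 * volume.real (ball (0 : EuclideanSpace ℝ (Fin n)) R)))) :=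
    (Continuous.tendsto (by fun_prop) 0).mono_left nhdsWithin_le_nhds
  have hle := ge_of_tendsto hlim (by filter_upwards [self_mem_nhdsWithin] with lam h using key lam h)
  have := mul_pos hR hmass
  linarith
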